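/- Capelli's identity (operator form). Fix n ≥ 1 and let S be the polynomial ring over R in the n² commuting variables x_{i,j} (1 ≤ i,j ≤ n). For 1 ≤ i,j ≤ n define the R-linear operator A_{i,j} on S by A_{i,j} := (∑_{k=1}^n X_{k,i} ∘ P_{k,j}) + h·(n−i)·δ_{i,j}·id. Then the column-ordered determinant of A equals det X composed with det P; that is, ∑_{σ ∈ S_n} sgn(σ) · A_{σ(1),1} ∘ A_{σ(2),2} ∘ ⋯ ∘ A_{σ(n),n} = (∑_{σ ∈ S_n} sgn(σ) · X_{σ(1),1} ∘ ⋯ ∘ X_{σ(n),n}) ∘ (∑_{τ ∈ S_n} sgn(τ) · P_{τ(1),1} ∘ ⋯ ∘ P_{τ(n),n}). -/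

import Mathlib

/-- Multiplication by the variable `x_{i,j}` on `R[x_{i,j} : 1 ≤ i,j ≤ n]`. -/
noncomputable def capX (n : ℕ) (R : Type*) [CommRing R] (i j : Fin n) :
    Module.End R (MvPolynomial (Fin n × Fin n) R) :=
  LinearMap.mulLeft R (MvPolynomial.X (i, j))

/-- The momentum operator `p_{i,j} = h ∂/∂x_{i,j}`. -/
noncomputable def capP (n : ℕ) (R : Type*) [CommRing R] (h : R) (i j : Fin n) :
    Module.End R (MvPolynomial (Fin n × Fin n) R) :=
  h • (MvPolynomial.pderiv (i, j)).toLinearMap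

/-- The Capelli operator `A_{i,j} = ∑_k X_{k,i} ∘ P_{k,j} + h (n - i) δ_{i,j} id`
(indices written `1,…,n`, so the `Fin n` index `i` corresponds to `i+1`). -/
noncomputable def capA (n : ℕ) (R : Type*) [CommRing R] (h : R) (i j : Fin n) :
    Module.End R (MvPolynomial (Fin n × Fin n) R) :=
  (∑ k : Fin n, capX n R k i * capP n R h k j) +
    (if i = j then h * (((n : ℤ) - ((i : ℕ) + 1) : ℤ) : R) else 0) • 1

section

open Equiv MvPolynomial

theorem Equiv.Perm.sum_sign_smul_fin_succ {M : Type*} [AddCommGroup M] {m : ℕ}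
    (F : Fin (m + 1) → (Fin m → Fin (m + 1)) → M) :
    ∑ σ : Perm (Fin (m + 1)), (Perm.sign σ : ℤ) • F (σ 0) (fun t => σ t.succ) =
      ∑ i : Fin (m + 1), ((-1 : ℤ) ^ (i : ℕ)) •
        ∑ τ : Perm (Fin m), (Perm.sign τ : ℤ) • F i (fun t => i.succAbove (τ t)) := by
  simp_rw [Finset.smul_sum]
  rw [← Fintype.sum_prod_type'
    (f := fun (i : Fin (m + 1)) (τ : Perm (Fin m)) => ((-1 : ℤ) ^ (i : ℕ)) •
        (Perm.sign τ : ℤ) • F i (fun t => i.succAbove (τ t)))]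
  symm
  let e : Fin (m + 1) × Perm (Fin m) → Perm (Fin (m + 1)) := fun p =>
    p.1.cycleRange⁻¹ * Perm.decomposeFin.symm (0, p.2)
  have e_zero (p) : e p 0 = p.1 := by
    simp [e, Perm.mul_apply, Perm.inv_def]
  have e_succ (p) (t : Fin m) : e p t.succ = p.1.succAbove (p.2 t) := by
    simp [e, Perm.mul_apply, Perm.inv_def]
  have e_bij : Function.Bijective e := by
    rw [Fintype.bijective_iff_injective_and_card]
    refine ⟨?_, by simp [Fintype.card_perm, Nat.factorial_succ]⟩
    rintro ⟨i, τ⟩ ⟨i', τ'⟩ hp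
    obtain rfl : i = i' := (e_zero (i, τ)).symm.trans (hp ▸ e_zero (i', τ'))
    congr 1
    ext1 t
    refine Fin.succAbove_right_injective (p := i) ?_
    rw [← e_succ (i, τ), hp, e_succ]
  refine Fintype.sum_bijective e e_bij _ _ fun p => ?_
  rw [e_zero, funext (e_succ p), smul_smul]
  congr 1
  simp [e, Fin.sign_cycleRange]

theorem Derivation.map_finset_prod {R A ι : Type*} [CommSemiring R] [CommSemiring A] [Algebra R A]
    [DecidableEq ι] (D : Derivation R A A) (s : Finset ι) (f : ι → A) :
    D (∏ i ∈ s, f i) = ∑ i ∈ s, D (f i) * ∏ j ∈ s.erase i, f j := by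
  induction s using Finset.induction_on with
  | empty => simp
  | insert a s ha ih =>
    rw [Finset.prod_insert ha, D.leibniz, Finset.sum_insert ha, Finset.erase_insert ha, ih,
      smul_eq_mul, smul_eq_mul, Finset.mul_sum, add_comm, mul_comm (D (f a))]
    rw [mul_comm]
    congr 1
    refine Finset.sum_congr rfl fun i hi => ?_
    rw [Finset.erase_insert_of_ne (by rintro rfl; exact ha hi),
      Finset.prod_insert (fun h' => ha (Finset.mem_of_mem_erase h'))]
    ring

/-- The operator `∑_k X_{k,i} ∘ P_{k,j} + h a δ_{i,j} id`. -/
noncomputable def capShift (n : ℕ) (R : Type*) [CommRing R] (h a : R) (i j : Fin n) :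
    Module.End R (MvPolynomial (Fin n × Fin n) R) :=
  (∑ k : Fin n, capX n R k i * capP n R h k j) + (if i = j then h * a else 0) • 1

variable {n m : ℕ} {R : Type*} [CommRing R]

theorem capP_prod_mul (h : R) (l j : Fin n) (k u : Fin m → Fin n)
    (Q : MvPolynomial (Fin n × Fin n) R) :
    capP n R h l j ((∏ t, X (k t, u t)) * Q) =
      (∏ t, X (k t, u t)) * capP n R h l j Q +
        ∑ s, if k s = l then if u s = j then
          h • ((∏ t ∈ Finset.univ.erase s, X (k t, u t)) * Q) else 0 else 0 := by
  simp only [capP, LinearMap.smul_apply, Derivation.coeFn_coe, pderiv_mul, smul_add,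
    Derivation.map_finset_prod, Finset.sum_mul, Finset.smul_sum, mul_smul_comm]
  rw [add_comm]
  congr 1
  refine Finset.sum_congr rfl fun s _ => ?_
  by_cases hk : k s = l
  · by_cases hu : u s = j
    · simp [hk, hu]
    · simp [hu]
  · simp [hk]

theorem capShift_prod_mul (h a : R) (i j : Fin n) (k u : Fin m → Fin n)
    (Q : MvPolynomial (Fin n × Fin n) R) :
    capShift n R h a i j ((∏ t, X (k t, u t)) * Q) =
      (∑ l, X (l, i) * ((∏ t, X (k t, u t)) * capP n R h l j Q)) +
      (∑ s, if u s = j then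
        h • (X (k s, i) * ((∏ t ∈ Finset.univ.erase s, X (k t, u t)) * Q)) else 0) +
      if i = j then (h * a) • ((∏ t, X (k t, u t)) * Q) else 0 := by
  simp only [capShift, capX, LinearMap.add_apply, LinearMap.sum_apply, Module.End.mul_apply,
    LinearMap.mulLeft_apply, capP_prod_mul, mul_add, Finset.sum_add_distrib, ite_smul, zero_smul, Finset.mul_sum, mul_ite, mul_zero, mul_smul_comm]
  rw [Finset.sum_comm (f := fun (l : Fin n) (s : Fin m) => if k s = l then _ else _)]
  by_cases hij : i = j <;> simp [hij]

theorem sum_sign_smul_exchange (h : R) (j : Fin n) (k : Fin m → Fin n) (r : Fin (m + 1) → Fin n)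
    (s : Fin m) (Q : MvPolynomial (Fin n × Fin n) R) :
    ∑ σ : Perm (Fin (m + 1)), (Perm.sign σ : ℤ) • (if r (σ s.succ) = j then
        h • (X (k s, r (σ 0)) *
          ((∏ t ∈ Finset.univ.erase s, X (k t, r (σ t.succ))) * Q)) else 0) =
      -∑ σ : Perm (Fin (m + 1)), (Perm.sign σ : ℤ) • (if r (σ 0) = j then
        h • ((∏ t, X (k t, r (σ t.succ))) * Q) else 0) := by
  rw [← Finset.sum_neg_distrib]
  refine Fintype.sum_equiv (Equiv.mulRight (swap 0 s.succ)) _ _ fun σ => ?_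
  have hprod : ∏ t ∈ Finset.univ.erase s, (X (k t, r (σ (swap 0 s.succ t.succ))) :
      MvPolynomial (Fin n × Fin n) R) =
      ∏ t ∈ Finset.univ.erase s, X (k t, r (σ t.succ)) := by
    refine Finset.prod_congr rfl fun t ht => ?_
    rw [swap_apply_of_ne_of_ne (Fin.succ_ne_zero t)
      (fun h' => Finset.ne_of_mem_erase ht (Fin.succ_injective _ h'))]
  simp only [Equiv.coe_mulRight, Perm.mul_apply, swap_apply_left, Perm.sign_mul,
    Perm.sign_swap (Fin.succ_ne_zero s).symm]
  rw [← Finset.mul_prod_erase _ _ (Finset.mem_univ s), hprod, swap_apply_right, mul_assoc]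
  split_ifs <;> simp

theorem sum_sign_smul_capShift (h : R) (j : Fin n) (k : Fin m → Fin n)
    (r : Fin (m + 1) → Fin n) (Q : MvPolynomial (Fin n × Fin n) R) :
    ∑ σ : Perm (Fin (m + 1)), (Perm.sign σ : ℤ) •
        capShift n R h m (r (σ 0)) j ((∏ t, X (k t, r (σ t.succ))) * Q) =
      ∑ σ : Perm (Fin (m + 1)), (Perm.sign σ : ℤ) •
        ∑ l, X (l, r (σ 0)) * ((∏ t, X (k t, r (σ t.succ))) * capP n R h l j Q) := by
  simp only [capShift_prod_mul, smul_add, Finset.sum_add_distrib]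
  rw [add_assoc, add_eq_left]
  simp only [Finset.smul_sum (s := (Finset.univ : Finset (Fin m)))]
  rw [Finset.sum_comm]
  simp only [sum_sign_smul_exchange]
  rw [Finset.sum_const, Finset.card_univ, Fintype.card_fin, smul_neg, neg_add_eq_zero,
    Finset.smul_sum]
  refine Finset.sum_congr rfl fun σ _ => ?_
  rw [smul_comm]
  congr 1
  split_ifs
  · rw [mul_comm h, mul_smul, Nat.cast_smul_eq_nsmul]
  · simp

theorem sum_sign_smul_prod_capShift (h : R) (r c : Fin m → Fin n)
    (f : MvPolynomial (Fin n × Fin n) R) :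
    ∑ σ : Perm (Fin m), (Perm.sign σ : ℤ) •
        (List.ofFn fun t => capShift n R h (((m : ℤ) - ((t : ℕ) + 1) : ℤ) : R)
          (r (σ t)) (c t)).prod f =
      ∑ σ : Perm (Fin m), (Perm.sign σ : ℤ) • ∑ k : Fin m → Fin n,
        (∏ t, X (k t, r (σ t))) * (List.ofFn fun t => capP n R h (k t) (c t)).prod f := by
  induction m with
  | zero => simp
  | succ m ih =>
    have tail (i : Fin (m + 1)) := ih (r ∘ i.succAbove) (c ∘ Fin.succ)
    simp only [Function.comp_apply] at tail
    have shift (t : Fin m) : (((m + 1 : ℕ) : ℤ) - (((t.succ : Fin (m + 1)) : ℕ) + 1) : ℤ) =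
        (m : ℤ) - ((t : ℕ) + 1) := by
      push_cast [Fin.val_succ]; ring
    calc
      _ = ∑ i : Fin (m + 1), ((-1 : ℤ) ^ (i : ℕ)) • capShift n R h m (r i) (c 0)
          (∑ τ : Perm (Fin m), (Perm.sign τ : ℤ) •
            (List.ofFn fun t => capShift n R h (((m : ℤ) - ((t : ℕ) + 1) : ℤ) : R)
              (r (i.succAbove (τ t))) (c t.succ)).prod f) := by
        simp only [List.ofFn_succ, List.prod_cons, Module.End.mul_apply, shift]
        rw [Perm.sum_sign_smul_fin_succ (fun i u =>
          capShift n R h ((((m + 1 : ℕ) : ℤ) - (((0 : Fin (m + 1)) : ℕ) + 1) : ℤ) : R) (r i) (c 0)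
            ((List.ofFn fun t => capShift n R h (((m : ℤ) - ((t : ℕ) + 1) : ℤ) : R)
              (r (u t)) (c t.succ)).prod f))]
        simp only [map_sum, map_zsmul]
        simp
      _ = ∑ σ : Perm (Fin (m + 1)), (Perm.sign σ : ℤ) • capShift n R h m (r (σ 0)) (c 0)
          (∑ k : Fin m → Fin n, (∏ t, X (k t, r (σ t.succ))) *
            (List.ofFn fun t => capP n R h (k t) (c t.succ)).prod f) := by
        rw [Perm.sum_sign_smul_fin_succ (fun i u => capShift n R h m (r i) (c 0)
          (∑ k : Fin m → Fin n, (∏ t, X (k t, r (u t))) *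
            (List.ofFn fun t => capP n R h (k t) (c t.succ)).prod f))]
        simp only [tail]
        simp only [map_sum, map_zsmul]
      _ = ∑ k : Fin m → Fin n, ∑ σ : Perm (Fin (m + 1)), (Perm.sign σ : ℤ) •
          ∑ l, X (l, r (σ 0)) * ((∏ t, X (k t, r (σ t.succ))) * capP n R h l (c 0)
            ((List.ofFn fun t => capP n R h (k t) (c t.succ)).prod f)) := by
        simp only [map_sum, Finset.smul_sum (s := (Finset.univ : Finset (Fin m → Fin n)))]
        rw [Finset.sum_comm]
        simp only [sum_sign_smul_capShift]
      _ = _ := by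
        rw [Finset.sum_comm]
        refine Finset.sum_congr rfl fun σ _ => ?_
        rw [← Finset.smul_sum, ← (Fin.consEquiv fun _ => Fin n).sum_comp, Fintype.sum_prod_type,
          Finset.sum_comm]
        simp [Fin.prod_univ_succ, List.ofFn_succ, mul_assoc]

theorem prod_ofFn_capX_apply (k u : Fin m → Fin n) (f : MvPolynomial (Fin n × Fin n) R) :
    (List.ofFn fun t => capX n R (k t) (u t)).prod f = (∏ t, X (k t, u t)) * f := by
  induction m with
  | zero => simp
  | succ m ih =>
    have := ih (fun t => k t.succ) (fun t => u t.succ)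
    rw [List.ofFn_succ, List.prod_cons, Module.End.mul_apply, this, Fin.prod_univ_succ,
      mul_assoc]
    rfl

theorem sum_det_submatrix_mul {A : Type*} [CommRing A] (M : Matrix (Fin n) (Fin n) A)
    (F : (Fin n → Fin n) → A) :
    ∑ k : Fin n → Fin n, (M.submatrix k id).det * F k =
      M.det * ∑ τ : Perm (Fin n), (Perm.sign τ : ℤ) • F τ := by
  rw [Finset.mul_sum]
  symm
  refine Fintype.sum_of_injective (fun τ : Perm (Fin n) => (τ : Fin n → Fin n))
    DFunLike.coe_injective _ _ (fun k hk => ?_) (fun τ => ?_)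
  · have hinj : ¬ Function.Injective k := fun hinj =>
      hk ⟨Equiv.ofBijective k (Finite.injective_iff_bijective.mp hinj), rfl⟩
    obtain ⟨i, j, hij, hne⟩ := Function.not_injective_iff.mp hinj
    rw [Matrix.det_zero_of_row_eq hne (by ext; simp [hij]), zero_mul]
  · rw [Matrix.det_permute, zsmul_eq_mul]
    ring

end

/-- **Capelli's identity** (operator form): the column-ordered determinant of `A`
equals `det X ∘ det P`. -/
theorem capelli_identity (n : ℕ) (hn : 1 ≤ n) (R : Type*) [CommRing R] (h : R) :
    ∑ σ : Equiv.Perm (Fin n), (Equiv.Perm.sign σ : ℤ) •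
        (List.ofFn fun i => capA n R h (σ i) i).prod =
      (∑ σ : Equiv.Perm (Fin n), (Equiv.Perm.sign σ : ℤ) •
          (List.ofFn fun i => capX n R (σ i) i).prod) *
      (∑ τ : Equiv.Perm (Fin n), (Equiv.Perm.sign τ : ℤ) •
          (List.ofFn fun i => capP n R h (τ i) i).prod) := by
  have hA (i j : Fin n) : capA n R h i j =
      capShift n R h (((n : ℤ) - ((j : ℕ) + 1) : ℤ) : R) i j := by
    unfold capA capShift
    by_cases hij : i = j
    · rw [hij]
    · simp [hij]
  refine LinearMap.ext fun f => ?_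
  have key := sum_sign_smul_prod_capShift h (id : Fin n → Fin n) id f
  let M : Matrix (Fin n) (Fin n) (MvPolynomial (Fin n × Fin n) R) :=
    Matrix.of fun i j => MvPolynomial.X (i, j)
  let F (k : Fin n → Fin n) := (List.ofFn fun t => capP n R h (k t) t).prod f
  calc
    _ = ∑ σ : Equiv.Perm (Fin n), (Equiv.Perm.sign σ : ℤ) • ∑ k : Fin n → Fin n,
        (∏ t, MvPolynomial.X (k t, σ t)) * F k := by
      simpa only [id, hA, LinearMap.sum_apply, LinearMap.smul_apply] using key
    _ = ∑ k : Fin n → Fin n, (M.submatrix k id).det * F k := by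
      simp only [Finset.smul_sum]
      rw [Finset.sum_comm]
      refine Finset.sum_congr rfl fun k _ => ?_
      rw [← Matrix.det_transpose, Matrix.det_apply, Finset.sum_mul]
      simp only [Units.smul_def, smul_mul_assoc]
      rfl
    _ = M.det * ∑ τ : Equiv.Perm (Fin n), (Equiv.Perm.sign τ : ℤ) • F τ :=
      sum_det_submatrix_mul M F
    _ = _ := by
      simp only [Module.End.mul_apply, LinearMap.sum_apply, LinearMap.smul_apply,
        prod_ofFn_capX_apply, Matrix.det_apply, Units.smul_def, Finset.sum_mul, smul_mul_assoc]
      rfl
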